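/- Suppose every triangle-free ISK4-free K₃,₃-free graph has a vertex of degree at most 2. Then every triangle-free ISK4-free graph is 3-colorable. -/

import Mathlib

/-- A graph H is a subdivision of K₄: there are four distinct branch vertices and six
internally disjoint paths joining each pair of them, which together cover all vertices
and edges of H, and whose internal vertices are not branch vertices. -/
def IsK4Subdivision {W : Type*} (H : SimpleGraph W) : Prop :=
  ∃ (b : Fin 4 → W), Function.Injective b ∧
    ∃ P : ∀ i j : Fin 4, H.Walk (b i) (b j),
      (∀ i j, i ≠ j → (P i j).IsPath) ∧
      (∀ i j, i ≠ j → P j i = (P i j).reverse) ∧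
      (∀ i j, i ≠ j → ∀ v ∈ (P i j).support, v ∈ Set.range b → v = b i ∨ v = b j) ∧
      (∀ i j k l, i ≠ j → k ≠ l → s(i, j) ≠ s(k, l) →
        ∀ v, v ∈ (P i j).support → v ∈ (P k l).support → v ∈ Set.range b) ∧
      (∀ v : W, ∃ i j, i ≠ j ∧ v ∈ (P i j).support) ∧
      (∀ e ∈ H.edgeSet, ∃ i j, i ≠ j ∧ e ∈ (P i j).edges)

/-- G is ISK4-free: no induced subgraph of G is a subdivision of K₄. -/
def ISK4Free {W : Type*} (G : SimpleGraph W) : Prop :=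
  ¬ ∃ S : Set W, IsK4Subdivision (G.induce S)

/-- G is K₃,₃-free: no induced subgraph of G is isomorphic to K₃,₃. -/
def K33Free {W : Type*} (G : SimpleGraph W) : Prop :=
  ¬ ∃ S : Set W, Nonempty (G.induce S ≃g completeBipartiteGraph (Fin 3) (Fin 3))

namespace SimpleGraph

variable {V W : Type*} {G : SimpleGraph V} {H : SimpleGraph W}

/-- A path, two vertices joined to both of its ends, and a further vertex joined to these two
form a subdivision of `K₄`. -/
theorem isK4Subdivision_of_path {a : W} (b : Fin 4 → W) (hb : Function.Injective b)
    (p : H.Walk (b 0) (b 1)) (hp : p.IsPath) (ha : a ∉ p.support) (h₂ : b 2 ∉ p.support)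
    (h₃ : b 3 ∉ p.support) (h₀₂ : H.Adj (b 0) (b 2)) (h₀₃ : H.Adj (b 0) (b 3))
    (h₁₂ : H.Adj (b 1) (b 2)) (h₁₃ : H.Adj (b 1) (b 3)) (h₂ₐ : H.Adj (b 2) a)
    (h₃ₐ : H.Adj a (b 3)) (hcover : ∀ v, v ∈ p.support ∨ v = b 2 ∨ v = b 3 ∨ v = a)
    (hedge : ∀ e ∈ H.edgeSet, e ∈ p.edges ∨ e = s(b 0, b 2) ∨ e = s(b 0, b 3) ∨
      e = s(b 1, b 2) ∨ e = s(b 1, b 3) ∨ e = s(b 2, a) ∨ e = s(a, b 3)) :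
    IsK4Subdivision H := by
  let P : ∀ i j : Fin 4, H.Walk (b i) (b j) := fun i j => match i, j with
    | 0, 0 => .nil
    | 0, 1 => p
    | 0, 2 => .cons h₀₂ .nil
    | 0, 3 => .cons h₀₃ .nil
    | 1, 0 => p.reverse
    | 1, 1 => .nil
    | 1, 2 => .cons h₁₂ .nil
    | 1, 3 => .cons h₁₃ .nil
    | 2, 0 => .cons h₀₂.symm .nil
    | 2, 1 => .cons h₁₂.symm .nil
    | 2, 2 => .nil
    | 2, 3 => .cons h₂ₐ (.cons h₃ₐ .nil)
    | 3, 0 => .cons h₀₃.symm .nil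
    | 3, 1 => .cons h₁₃.symm .nil
    | 3, 2 => .cons h₃ₐ.symm (.cons h₂ₐ.symm .nil)
    | 3, 3 => .nil
  have hP : ∀ i j, ∀ v ∈ (P i j).support, v = b i ∨ v = b j ∨
      (s(i, j) = s(0, 1) ∧ v ∈ p.support) ∨ (s(i, j) = s(2, 3) ∧ v = a) := by
    intro i j v hv
    fin_cases i <;> fin_cases j <;> simp [P] at hv ⊢ <;> tauto
  have h₀ := p.start_mem_support
  have h₁ := p.end_mem_support
  refine ⟨b, hb, P, ?_, ?_, ?_, ?_, ?_, ?_⟩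
  · intro i j hij
    have := h₂ₐ.ne
    have := h₃ₐ.ne
    fin_cases i <;> fin_cases j <;> simp [P, Walk.cons_isPath_iff, hb.eq_iff] at hij ⊢ <;>
      grind
  · intro i j hij
    fin_cases i <;> fin_cases j <;> simp [P] at hij ⊢
  · rintro i j hij v hv ⟨k, rfl⟩
    rcases hP i j _ hv with h | h | ⟨h, hs⟩ | ⟨h, hs⟩
    · exact .inl h
    · exact .inr h
    · have hk : k = 0 ∨ k = 1 := by
        fin_cases k <;> simp_all
      have : k = i ∨ k = j := by
        rcases Sym2.eq_iff.mp h with ⟨rfl, rfl⟩ | ⟨rfl, rfl⟩ <;> tauto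
      exact this.imp (congrArg b) (congrArg b)
    · subst hs
      exfalso
      fin_cases k
      exacts [ha h₀, ha h₁, h₂ₐ.ne rfl, h₃ₐ.ne rfl]
  · intro i j k l hij hkl hne v hv hv'
    by_contra hvb
    have hb' : ∀ i, v ≠ b i := fun i h => hvb ⟨i, h.symm⟩
    have := hP i j v hv
    have := hP k l v hv'
    simp only [hb', false_or] at *
    grind
  · intro v
    rcases hcover v with h | rfl | rfl | rfl
    · exact ⟨0, 1, by decide, h⟩
    · exact ⟨0, 2, by decide, by simp [P]⟩
    · exact ⟨0, 3, by decide, by simp [P]⟩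
    · exact ⟨2, 3, by decide, by simp [P]⟩
  · intro e he
    rcases hedge e he with h | rfl | rfl | rfl | rfl | rfl | rfl
    · exact ⟨0, 1, by decide, h⟩
    · exact ⟨0, 2, by decide, by simp [P]⟩
    · exact ⟨0, 3, by decide, by simp [P]⟩
    · exact ⟨1, 2, by decide, by simp [P]⟩
    · exact ⟨1, 3, by decide, by simp [P]⟩
    · exact ⟨2, 3, by decide, by simp [P]⟩
    · exact ⟨2, 3, by decide, by simp [P]⟩

theorem _root_.IsK4Subdivision.map_iso (e : G ≃g H) (h : IsK4Subdivision G) :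
    IsK4Subdivision H := by
  obtain ⟨b, hb, P, h₁, h₂, h₃, h₄, h₅, h₆⟩ := h
  refine ⟨e ∘ b, e.injective.comp hb, fun i j => (P i j).map e.toHom, ?_, ?_, ?_, ?_, ?_, ?_⟩
  · exact fun i j hij => (h₁ i j hij).map e.injective
  · intro i j hij
    simp [h₂ i j hij]
  · intro i j hij v hv hvb
    obtain ⟨k, rfl⟩ := hvb
    simpa using h₃ i j hij (b k) (by simpa using hv) ⟨k, rfl⟩
  · intro i j k l hij hkl hne v hv hv'
    obtain ⟨w, rfl⟩ := e.surjective v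
    obtain ⟨m, hm⟩ := h₄ i j k l hij hkl hne w (by simpa using hv) (by simpa using hv')
    exact ⟨m, by simp [hm]⟩
  · intro v
    obtain ⟨w, rfl⟩ := e.surjective v
    simpa using h₅ w
  · intro x hx
    induction x with | _ x y
    obtain ⟨x, rfl⟩ := e.surjective x
    obtain ⟨y, rfl⟩ := e.surjective y
    obtain ⟨i, j, hij, hm⟩ := h₆ s(x, y) (e.map_adj_iff.mp hx)
    refine ⟨i, j, hij, ?_⟩
    rw [Walk.edges_map]
    exact List.mem_map_of_mem (f := Sym2.map e.toHom) hm

theorem _root_.ISK4Free.induce (h : ISK4Free G) (S : Set V) : ISK4Free (G.induce S) := by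
  rintro ⟨T, hT⟩
  refine h ⟨Subtype.val '' T, hT.map_iso ?_⟩
  exact
    { toEquiv := Equiv.Set.image _ T Subtype.val_injective
      map_rel_iff' := Iff.rfl }

/-- An induced path whose two ends are the only attachments of `b₁` and `b₂` on it, together with
a further common neighbour `a₃` of `b₁` and `b₂`, gives an induced subdivision of `K₄`. -/
theorem not_ISK4Free_of_path {a₁ a₂ a₃ b₁ b₂ : V} (p : G.Walk a₁ a₂) (hp : p.IsPath)
    (hind : ∀ u ∈ p.support, ∀ v ∈ p.support, G.Adj u v → s(u, v) ∈ p.edges)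
    (ha : a₁ ≠ a₂) (hb : b₁ ≠ b₂) (hbb : ¬ G.Adj b₁ b₂) (ha₃ : a₃ ∉ p.support)
    (hb₁ : b₁ ∉ p.support) (hb₂ : b₂ ∉ p.support) (h₁₁ : G.Adj a₁ b₁) (h₁₂ : G.Adj a₁ b₂)
    (h₂₁ : G.Adj a₂ b₁) (h₂₂ : G.Adj a₂ b₂) (h₃₁ : G.Adj a₃ b₁) (h₃₂ : G.Adj a₃ b₂)
    (hn₃ : ∀ v ∈ p.support, ¬ G.Adj v a₃)
    (hn₁ : ∀ v ∈ p.support, G.Adj v b₁ → v = a₁ ∨ v = a₂)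
    (hn₂ : ∀ v ∈ p.support, G.Adj v b₂ → v = a₁ ∨ v = a₂) : ¬ ISK4Free G := by
  let S : Set V := {v | v ∈ p.support ∨ v = b₁ ∨ v = b₂ ∨ v = a₃}
  have hS : ∀ v ∈ p.support, v ∈ S := fun v hv => .inl hv
  have m₁ := p.start_mem_support
  have m₂ := p.end_mem_support
  let c : Fin 4 → S := ![⟨a₁, hS _ m₁⟩, ⟨a₂, hS _ m₂⟩, ⟨b₁, by simp [S]⟩, ⟨b₂, by simp [S]⟩]
  have hsupp : ∀ v : S, v ∈ (p.induce S hS).support ↔ v.1 ∈ p.support := by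
    simp [Walk.support_induce]
  have hedges : ∀ x y : S, s(x, y) ∈ (p.induce S hS).edges ↔ s(x.1, y.1) ∈ p.edges := by
    intro x y
    have hmap : p.edges = (p.induce S hS).edges.map (Sym2.map Subtype.val) :=
      (congrArg Walk.edges (Walk.map_induce p hS)).symm.trans (Walk.edges_map _ _)
    rw [hmap]
    exact (List.mem_map_of_injective (Sym2.map.injective Subtype.val_injective)
      (a := s(x, y))).symm
  refine fun hfree => hfree ⟨S, isK4Subdivision_of_path (a := ⟨a₃, by simp [S]⟩) c ?_
    (p.induce S hS) ?_ ?_ ?_ ?_ h₁₁ h₁₂ h₂₁ h₂₂ h₃₁.symm h₃₂ ?_ ?_⟩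
  · have := h₁₁.ne
    have := h₁₂.ne
    have := h₂₁.ne
    have := h₂₂.ne
    intro i j h
    have := congrArg Subtype.val h
    fin_cases i <;> fin_cases j <;> first | rfl | (simp [c] at this; grind)
  · exact Walk.IsPath.of_map (f := (Embedding.induce S).toHom)
      ((iff_of_eq (congrArg Walk.IsPath (Walk.map_induce p hS))).mpr hp)
  · exact fun h => ha₃ ((hsupp _).mp h)
  · exact fun h => hb₁ ((hsupp _).mp h)
  · exact fun h => hb₂ ((hsupp _).mp h)
  · rintro ⟨v, hv⟩
    refine (or_congr_left (hsupp ⟨v, hv⟩)).mpr ?_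
    simpa [c, S] using hv
  · intro e he
    induction e with | _ x y
    refine (or_congr_left (hedges x y)).mpr ?_
    obtain ⟨x, hx⟩ := x
    obtain ⟨y, hy⟩ := y
    replace he : G.Adj x y := he
    have he' := he.symm
    simp only [c, Sym2.eq_iff, Subtype.mk.injEq, Matrix.cons_val]
    have := h₃₁.symm
    have := h₃₂.symm
    have hl : ∀ x, ¬ G.Adj x x := fun x => G.irrefl
    simp only [S, Set.mem_ofPred_eq] at hx hy
    rcases hx with hx | rfl | rfl | rfl <;> rcases hy with hy | rfl | rfl | rfl
    · exact .inl (hind _ hx _ hy he)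
    all_goals grind

/-- A shortest walk is induced. -/
theorem Walk.mk_mem_edges_of_adj_of_length_eq_dist {u v x y : V} (p : G.Walk u v)
    (hp : p.length = G.dist u v) (hx : x ∈ p.support) (hy : y ∈ p.support) (h : G.Adj x y) :
    s(x, y) ∈ p.edges := by
  obtain ⟨i, rfl, hi⟩ := Walk.mem_support_iff_exists_getVert.mp hx
  obtain ⟨j, rfl, hj⟩ := Walk.mem_support_iff_exists_getVert.mp hy
  wlog hij : i ≤ j generalizing i j
  · rw [Sym2.eq_swap]
    exact this j hj hy i hi hx h.symm (by omega)
  have hlen := dist_le ((p.take i).append (.cons h (p.drop j)))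
  rw [← hp, Walk.length_append, Walk.length_cons, Walk.take_length, Walk.drop_length] at hlen
  have hne : i ≠ j := fun hij => h.ne (by rw [hij])
  obtain rfl : j = i + 1 := by omega
  exact p.mk_mem_edges_iff_exists.mpr ⟨i, hj, rfl⟩

/-- Joining two vertices on the same side of a biclique by an induced path outside of it gives an
induced subdivision of `K₄`. -/
theorem not_ISK4Free_of_inner_path {a₁ a₂ a₃ b₁ b₂ u w : V} (r : G.Walk u w) (hr : r.IsPath)
    (hind : ∀ s ∈ r.support, ∀ t ∈ r.support, G.Adj s t → s(s, t) ∈ r.edges)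
    (hu : G.Adj a₁ u) (hw : G.Adj w a₂) (hr₁ : a₁ ∉ r.support) (hr₂ : a₂ ∉ r.support)
    (hr₃ : a₃ ∉ r.support) (hrb₁ : b₁ ∉ r.support) (hrb₂ : b₂ ∉ r.support)
    (ha : a₁ ≠ a₂) (ha₁ : a₃ ≠ a₁) (ha₂ : a₃ ≠ a₂) (hb : b₁ ≠ b₂)
    (h₁₂ : ¬ G.Adj a₁ a₂) (h₁₃ : ¬ G.Adj a₁ a₃) (h₂₃ : ¬ G.Adj a₂ a₃) (hbb : ¬ G.Adj b₁ b₂)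
    (hab₁₁ : G.Adj a₁ b₁) (hab₁₂ : G.Adj a₁ b₂) (hab₂₁ : G.Adj a₂ b₁) (hab₂₂ : G.Adj a₂ b₂)
    (hab₃₁ : G.Adj a₃ b₁) (hab₃₂ : G.Adj a₃ b₂)
    (hn₁ : ∀ v ∈ r.support, G.Adj a₁ v → v = u) (hn₂ : ∀ v ∈ r.support, G.Adj v a₂ → v = w)
    (hn₃ : ∀ v ∈ r.support, ¬ G.Adj v a₃) (hnb₁ : ∀ v ∈ r.support, ¬ G.Adj v b₁)
    (hnb₂ : ∀ v ∈ r.support, ¬ G.Adj v b₂) : ¬ ISK4Free G := by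
  let p : G.Walk a₁ a₂ := .cons hu (r.concat hw)
  have hpmem : ∀ v, v ∈ p.support ↔ v = a₁ ∨ v ∈ r.support ∨ v = a₂ := by
    simp [p, Walk.support_concat]
  have hpedge : ∀ e, e ∈ p.edges ↔ e = s(a₁, u) ∨ e ∈ r.edges ∨ e = s(w, a₂) := by
    simp [p, Walk.edges_concat]
  have hpath : p.IsPath := by
    refine (Walk.cons_isPath_iff _ _).mpr ⟨hr.concat hr₂ hw, ?_⟩
    simp [Walk.support_concat, hr₁, ha]
  clear_value p
  refine not_ISK4Free_of_path (a₃ := a₃) p hpath ?_ ha hb hbb ?_ ?_ ?_ hab₁₁ hab₁₂ hab₂₁ hab₂₂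
    hab₃₁ hab₃₂ ?_ ?_ ?_
  · intro s hs t ht hst
    rw [hpedge]
    have hl := hst.ne
    have hst' := hst.symm
    rw [hpmem] at hs ht
    simp only [Sym2.eq_iff]
    rcases hs with rfl | hs | rfl <;> rcases ht with rfl | ht | rfl
    case inr.inl.inr.inl => exact .inr (.inl (hind s hs t ht hst))
    all_goals grind
  all_goals simp only [hpmem]
  · tauto
  · have := hab₁₁.ne'
    have := hab₂₁.ne'
    tauto
  · have := hab₁₂.ne'
    have := hab₂₂.ne'
    tauto
  · rintro v (rfl | hv | rfl)
    exacts [h₁₃, hn₃ v hv, h₂₃]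
  · rintro v (rfl | hv | rfl) h
    exacts [.inl rfl, absurd h (hnb₁ v hv), .inr rfl]
  · rintro v (rfl | hv | rfl) h
    exacts [.inl rfl, absurd h (hnb₂ v hv), .inr rfl]

/-- A minimal walk outside a biclique joining two nonadjacent attachments gives an induced
subdivision of `K₄`. -/
theorem not_ISK4Free_of_minimal_walk {A B : Finset V} {K : Set V}
    (hK : ∀ v, v ∈ K ↔ v ∈ A ∨ v ∈ B) (hA : 3 ≤ A.card) (hB : 3 ≤ B.card)
    (hAB : ∀ a ∈ A, ∀ b ∈ B, G.Adj a b) (hT : ∀ a b c, G.Adj a b → G.Adj b c → ¬ G.Adj a c)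
    (huniq : ∀ v ∉ K, ∀ x ∈ K, ∀ y ∈ K, G.Adj v x → G.Adj v y → x = y)
    {u w : ↥Kᶜ} (q : (G.induce Kᶜ).Walk u w) {x y : V} (hx : x ∈ A) (hy : y ∈ A) (hxy : x ≠ y)
    (hxu : G.Adj x u) (hwy : G.Adj w y)
    (hmin : ∀ x' ∈ K, ∀ y' ∈ K, x' ≠ y' → ¬ G.Adj x' y' →
      ∀ (u' w' : ↥Kᶜ) (q' : (G.induce Kᶜ).Walk u' w'), G.Adj x' u' → G.Adj w' y' →
        q.length ≤ q'.length) :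
    ¬ ISK4Free G := by
  classical
  have hAK : ∀ a ∈ A, a ∈ K := fun a ha => (hK a).mpr (.inl ha)
  have hBK : ∀ b ∈ B, b ∈ K := fun b hb => (hK b).mpr (.inr hb)
  have hdisj : ∀ a ∈ A, a ∉ B := fun a ha hb => G.irrefl (hAB a ha a hb)
  obtain ⟨a₀, ha₀⟩ : A.Nonempty := Finset.card_pos.mp (by omega)
  obtain ⟨b₀, hb₀⟩ : B.Nonempty := Finset.card_pos.mp (by omega)
  have hAA : ∀ a ∈ A, ∀ a' ∈ A, ¬ G.Adj a a' := fun a ha a' ha' =>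
    hT a b₀ a' (hAB a ha _ hb₀) (hAB a' ha' _ hb₀).symm
  have hBB : ∀ b ∈ B, ∀ b' ∈ B, ¬ G.Adj b b' := fun b hb b' hb' =>
    hT b a₀ b' (hAB _ ha₀ b hb).symm (hAB _ ha₀ b' hb')
  have hdist : q.length = (G.induce Kᶜ).dist u w := by
    obtain ⟨q', hq'⟩ := q.reachable.exists_walk_length_eq_dist
    exact (hq' ▸ hmin x (hAK x hx) y (hAK y hy) hxy (hAA x hx y hy) u w q' hxu hwy).antisymm
      (dist_le q)
  have hends : ∀ i j, i ≤ j → j ≤ q.length → ∀ z ∈ K, ∀ z' ∈ K, z ≠ z' → ¬ G.Adj z z' →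
      G.Adj z (q.getVert i) → G.Adj z' (q.getVert j) →
      z = x ∧ z' = y ∧ q.getVert i = u ∧ q.getVert j = w := by
    intro i j hij hj z hz z' hz' hne hadj hzi hzj
    have hlen := hmin z hz z' hz' hne hadj _ _ ((q.drop i).take (j - i)) hzi
      (by rw [Walk.drop_getVert, Nat.add_sub_cancel' hij]; exact hzj.symm)
    rw [Walk.take_length, Walk.drop_length] at hlen
    obtain rfl : i = 0 := by omega
    obtain rfl : j = q.length := by omega
    rw [Walk.getVert_zero] at hzi ⊢
    rw [Walk.getVert_length] at hzj ⊢
    exact ⟨huniq _ u.2 _ hz _ (hAK x hx) hzi.symm hxu.symm,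
      huniq _ w.2 _ hz' _ (hAK y hy) hzj.symm hwy, rfl, rfl⟩
  have hattach : ∀ s ∈ q.support, ∀ s' ∈ q.support, ∀ z ∈ K, ∀ z' ∈ K, z ≠ z' →
      ¬ G.Adj z z' → G.Adj z s → G.Adj z' s' →
      (z = x ∧ z' = y ∧ s = u ∧ s' = w) ∨ (z' = x ∧ z = y ∧ s' = u ∧ s = w) := by
    intro s hs s' hs' z hz z' hz' hne hadj hzs hzs'
    obtain ⟨i, rfl, hi⟩ := Walk.mem_support_iff_exists_getVert.mp hs
    obtain ⟨j, rfl, hj⟩ := Walk.mem_support_iff_exists_getVert.mp hs'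
    rcases le_total i j with hij | hij
    · exact .inl (hends i j hij hj z hz z' hz' hne hadj hzs hzs')
    · exact .inr (hends j i hij hi z' hz' z hz hne.symm (fun h => hadj h.symm) hzs' hzs)
  have hattachA : ∀ s ∈ q.support, ∀ z ∈ A, G.Adj z s → (z = x ∧ s = u) ∨ (z = y ∧ s = w) := by
    intro s hs z hz hzs
    by_cases hzx : z = x
    · subst hzx
      have := hattach s hs w q.end_mem_support z (hAK z hz) y (hAK y hy) hxy (hAA z hz y hy)
        hzs hwy.symm
      tauto
    · have := hattach s hs u q.start_mem_support z (hAK z hz) x (hAK x hx) hzx (hAA z hz x hx)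
        hzs hxu
      tauto
  let T := B.filter fun b => ∃ s ∈ q.support, G.Adj b s
  have hT₁ : T.card ≤ 1 := by
    refine Finset.card_le_one.mpr fun b hb b' hb' => ?_
    obtain ⟨hb, s, hs, hbs⟩ := Finset.mem_filter.mp hb
    obtain ⟨hb', s', hs', hbs'⟩ := Finset.mem_filter.mp hb'
    by_contra hne
    rcases hattach s hs s' hs' b (hBK b hb) b' (hBK b' hb') hne (hBB b hb b' hb') hbs hbs' with
      ⟨rfl, -⟩ | ⟨rfl, -⟩
    · exact hdisj _ hx hb
    · exact hdisj _ hx hb'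
  obtain ⟨b₁, hb₁, b₂, hb₂, hb⟩ : ∃ b₁ ∈ B \ T, ∃ b₂ ∈ B \ T, b₁ ≠ b₂ := by
    refine Finset.one_lt_card.mp ?_
    have := Finset.le_card_sdiff T B
    omega
  obtain ⟨a, ha⟩ : ((A.erase x).erase y).Nonempty := by
    refine Finset.card_pos.mp ?_
    rw [Finset.card_erase_of_mem (by simp [hxy.symm, hy]), Finset.card_erase_of_mem hx]
    omega
  obtain ⟨hay, hax, ha⟩ : a ≠ y ∧ a ≠ x ∧ a ∈ A := by simpa using ha
  have hTn : ∀ b ∈ B \ T, b ∈ B ∧ ∀ s ∈ q.support, ¬ G.Adj b s := by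
    intro b hb
    simp only [T, Finset.mem_sdiff, Finset.mem_filter] at hb
    exact ⟨hb.1, fun s hs hbs => hb.2 ⟨hb.1, s, hs, hbs⟩⟩
  obtain ⟨hb₁, hb₁q⟩ := hTn b₁ hb₁
  obtain ⟨hb₂, hb₂q⟩ := hTn b₂ hb₂
  obtain ⟨r, hrsupp, hrpath, hredges⟩ : ∃ r : G.Walk u.1 w.1,
      r.support = q.support.map Subtype.val ∧ r.IsPath ∧
        r.edges = q.edges.map (Sym2.map Subtype.val) :=
    ⟨q.map (Embedding.induce Kᶜ).toHom, Walk.support_map _ _,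
      (q.isPath_of_length_eq_dist hdist).map Subtype.val_injective, Walk.edges_map _ _⟩
  have hrmem : ∀ v, v ∈ r.support ↔ ∃ s ∈ q.support, s.1 = v := by
    simp [hrsupp]
  have hrK : ∀ v ∈ r.support, v ∉ K := by
    intro v hv
    obtain ⟨s, -, rfl⟩ := (hrmem v).mp hv
    exact s.2
  have hBne : ∀ b ∈ B, ∀ a ∈ A, b ≠ a := fun b hb a ha h => hdisj a ha (h ▸ hb)
  have hrA : ∀ v ∈ r.support, ∀ z ∈ A, G.Adj z v → (z = x ∧ v = u) ∨ (z = y ∧ v = w) := by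
    intro v hv z hz hzv
    obtain ⟨s, hs, rfl⟩ := (hrmem v).mp hv
    exact (hattachA s hs z hz hzv).imp (fun h => ⟨h.1, congrArg _ h.2⟩)
      (fun h => ⟨h.1, congrArg _ h.2⟩)
  have hrB : ∀ b, (∀ s ∈ q.support, ¬ G.Adj b s) → ∀ v ∈ r.support, ¬ G.Adj v b := by
    intro b hb v hv hvb
    obtain ⟨s, hs, rfl⟩ := (hrmem v).mp hv
    exact hb s hs hvb.symm
  refine not_ISK4Free_of_inner_path (a₃ := a) r hrpath ?_ hxu hwy
    (fun h => hrK _ h (hAK _ hx)) (fun h => hrK _ h (hAK _ hy)) (fun h => hrK _ h (hAK _ ha))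
    (fun h => hrK _ h (hBK _ hb₁)) (fun h => hrK _ h (hBK _ hb₂)) hxy hax hay hb
    (hAA _ hx _ hy) (hAA _ hx _ ha) (hAA _ hy _ ha) (hBB _ hb₁ _ hb₂)
    (hAB _ hx _ hb₁) (hAB _ hx _ hb₂) (hAB _ hy _ hb₁) (hAB _ hy _ hb₂) (hAB _ ha _ hb₁)
    (hAB _ ha _ hb₂) ?_ ?_ ?_ (hrB b₁ hb₁q) (hrB b₂ hb₂q)
  · intro s hs t ht hst
    obtain ⟨s, hsq, rfl⟩ := (hrmem s).mp hs
    obtain ⟨t, htq, rfl⟩ := (hrmem t).mp ht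
    rw [hredges]
    exact List.mem_map_of_mem (f := Sym2.map Subtype.val)
      (q.mk_mem_edges_of_adj_of_length_eq_dist hdist hsq htq hst)
  · intro v hv hvx
    rcases hrA v hv x hx hvx with h | h
    exacts [h.2, absurd h.1 hxy]
  · intro v hv hvy
    rcases hrA v hv y hy hvy.symm with h | h
    exacts [absurd h.1.symm hxy, h.2]
  · intro v hv hva
    rcases hrA v hv a ha hva.symm with h | h
    exacts [hax h.1, hay h.1]

/-- In a triangle-free `ISK4`-free graph, a vertex outside a biclique with two neighbours on one
side is complete to that side. -/
theorem eq_of_adj_of_adj_of_not_complete {A B : Finset V} (hB : 2 ≤ B.card)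
    (hAB : ∀ a ∈ A, ∀ b ∈ B, G.Adj a b) (hT : ∀ a b c, G.Adj a b → G.Adj b c → ¬ G.Adj a c)
    (hfree : ISK4Free G) {v : V} (hvA : v ∉ A) (hvB : v ∉ B) (hv : ¬ ∀ a ∈ A, G.Adj a v)
    {x y : V} (hx : x ∈ A) (hy : y ∈ A) (hvx : G.Adj v x) (hvy : G.Adj v y) : x = y := by
  by_contra hxy
  push Not at hv
  obtain ⟨a, ha, hav⟩ := hv
  obtain ⟨b₁, hb₁, b₂, hb₂, hb⟩ := Finset.one_lt_card.mp hB
  have hAA : ∀ a ∈ A, ∀ a' ∈ A, ¬ G.Adj a a' := fun a ha a' ha' =>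
    hT a b₁ a' (hAB a ha _ hb₁) (hAB a' ha' _ hb₁).symm
  have hvb : ∀ b ∈ B, ¬ G.Adj v b := fun b hb => hT v x b hvx (hAB x hx b hb)
  have hne : ∀ z, z ∈ A ∨ z ∈ B → z ∉ (Walk.nil : G.Walk v v).support := by
    rintro z hz h
    obtain rfl := by simpa using h
    tauto
  refine not_ISK4Free_of_inner_path (a₃ := a) (Walk.nil : G.Walk v v) .nil (by simp) hvx.symm hvy
    (hne _ (.inl hx)) (hne _ (.inl hy)) (hne _ (.inl ha)) (hne _ (.inr hb₁)) (hne _ (.inr hb₂))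
    hxy (fun h => hav (h ▸ hvx.symm)) (fun h => hav (h ▸ hvy.symm)) hb
    (hAA _ hx _ hy) (hAA _ hx _ ha) (hAA _ hy _ ha)
    (hT b₁ x b₂ (hAB _ hx _ hb₁).symm (hAB _ hx _ hb₂))
    (hAB _ hx _ hb₁) (hAB _ hx _ hb₂) (hAB _ hy _ hb₁) (hAB _ hy _ hb₂) (hAB _ ha _ hb₁)
    (hAB _ ha _ hb₂) ?_ ?_ ?_ ?_ ?_ hfree
  · simp
  · simp
  · simpa using fun h => hav h.symm
  · simpa using hvb _ hb₁
  · simpa using hvb _ hb₂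

/-- Two vertices of a maximal biclique that attach to the same component of the rest of a
triangle-free `ISK4`-free graph are equal or adjacent. -/
theorem adj_of_attach_of_maximal_biclique {A B : Finset V} {K : Set V}
    (hK : ∀ v, v ∈ K ↔ v ∈ A ∨ v ∈ B) (hA : 3 ≤ A.card) (hB : 3 ≤ B.card)
    (hAB : ∀ a ∈ A, ∀ b ∈ B, G.Adj a b) (hT : ∀ a b c, G.Adj a b → G.Adj b c → ¬ G.Adj a c)
    (hfree : ISK4Free G) (hmaxA : ∀ v ∉ B, ¬ ∀ a ∈ A, G.Adj a v)
    (hmaxB : ∀ v ∉ A, ¬ ∀ b ∈ B, G.Adj b v) {u w : ↥Kᶜ} (huw : (G.induce Kᶜ).Reachable u w)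
    {x y : V} (hx : x ∈ K) (hy : y ∈ K) (hxy : x ≠ y) (hxu : G.Adj x u) (hwy : G.Adj w y) :
    G.Adj x y := by
  classical
  by_contra hadj
  have hBA : ∀ b ∈ B, ∀ a ∈ A, G.Adj b a := fun b hb a ha => (hAB a ha b hb).symm
  have huniq : ∀ v ∉ K, ∀ x ∈ K, ∀ y ∈ K, G.Adj v x → G.Adj v y → x = y := by
    intro v hv x hx y hy hvx hvy
    rw [hK, not_or] at hv
    rw [hK] at hx hy
    rcases hx with hx | hx <;> rcases hy with hy | hy
    · exact eq_of_adj_of_adj_of_not_complete (by omega) hAB hT hfree hv.1 hv.2 (hmaxA v hv.2)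
        hx hy hvx hvy
    · exact absurd hvy (hT v x y hvx (hAB x hx y hy))
    · exact absurd hvy (hT v x y hvx (hBA x hx y hy))
    · exact eq_of_adj_of_adj_of_not_complete (by omega) hBA hT hfree hv.2 hv.1 (hmaxB v hv.1)
        hx hy hvx hvy
  have hex : ∃ n, ∃ x ∈ K, ∃ y ∈ K, x ≠ y ∧ ¬ G.Adj x y ∧
      ∃ (u w : ↥Kᶜ) (q : (G.induce Kᶜ).Walk u w), G.Adj x u ∧ G.Adj w y ∧ q.length = n := by
    obtain ⟨q⟩ := huw
    exact ⟨_, x, hx, y, hy, hxy, hadj, u, w, q, hxu, hwy, rfl⟩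
  obtain ⟨x, hx, y, hy, hxy, hadj, u, w, q, hxu, hwy, hq⟩ := Nat.find_spec hex
  have hmin : ∀ x' ∈ K, ∀ y' ∈ K, x' ≠ y' → ¬ G.Adj x' y' →
      ∀ (u' w' : ↥Kᶜ) (q' : (G.induce Kᶜ).Walk u' w'), G.Adj x' u' → G.Adj w' y' →
        q.length ≤ q'.length := fun x' hx' y' hy' hne hadj' u' w' q' hxu' hwy' =>
    hq ▸ Nat.find_min' hex ⟨x', hx', y', hy', hne, hadj', u', w', q', hxu', hwy', rfl⟩
  rcases (hK x).mp hx with hxA | hxB <;> rcases (hK y).mp hy with hyA | hyB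
  · exact not_ISK4Free_of_minimal_walk hK hA hB hAB hT huniq q hxA hyA hxy hxu hwy hmin hfree
  · exact hadj (hAB x hxA y hyB)
  · exact hadj (hBA x hxB y hyA)
  · exact not_ISK4Free_of_minimal_walk (fun v => (hK v).trans or_comm) hB hA hBA hT huniq q
      hxB hyB hxy hxu hwy hmin hfree

/-- Colorings of two pieces of a graph that overlap in a clique can be glued. -/
theorem colorable_of_clique_separation {C N : Set V} {n : ℕ} (hN : G.IsClique N)
    (hNC : N ⊆ Cᶜ) (hC : ∀ c ∈ C, ∀ v, G.Adj c v → v ∈ C ∨ v ∈ N)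
    (h₁ : (G.induce Cᶜ).Colorable n) (h₂ : (G.induce (C ∪ N)).Colorable n) :
    G.Colorable n := by
  classical
  obtain ⟨f⟩ := h₁
  obtain ⟨g⟩ := h₂
  let f' : N → Fin n := fun x => f ⟨x, hNC x.2⟩
  let g' : N → Fin n := fun x => g ⟨x, .inr x.2⟩
  have hf : Function.Injective f' := fun x y h => by
    by_contra hne
    exact f.valid (v := ⟨x, hNC x.2⟩) (w := ⟨y, hNC y.2⟩)
      (hN x.2 y.2 fun h => hne (Subtype.ext h)) h
  have hg : Function.Injective g' := fun x y h => by
    by_contra hne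
    exact g.valid (v := ⟨x, .inr x.2⟩) (w := ⟨y, .inr y.2⟩)
      (hN x.2 y.2 fun h => hne (Subtype.ext h)) h
  have := Finite.of_injective f' hf
  obtain ⟨σ, hσ⟩ := Equiv.Perm.exists_extending_pair g' f' hg hf
  let c : V → Fin n := fun v => if h : v ∈ C then σ (g ⟨v, .inl h⟩) else f ⟨v, h⟩
  have hcg : ∀ v (h : v ∈ C ∪ N), c v = σ (g ⟨v, h⟩) := by
    rintro v (h | h)
    · simp [c, h]
    · have hv : v ∉ C := hNC h
      simpa [c, hv] using (hσ ⟨v, h⟩).symm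
  have hcf : ∀ v (h : v ∈ Cᶜ), c v = f ⟨v, h⟩ := fun v h => dif_neg h
  have hin : ∀ v ∈ C, ∀ w, G.Adj v w → c v ≠ c w := by
    intro v hv w hvw
    have hw : w ∈ C ∪ N := hC v hv w hvw
    rw [hcg v (.inl hv), hcg w hw]
    exact σ.injective.ne (g.valid (v := ⟨v, .inl hv⟩) (w := ⟨w, hw⟩) hvw)
  refine ⟨Coloring.mk c fun {v w} hvw => ?_⟩
  by_cases hv : v ∈ C
  · exact hin v hv w hvw
  by_cases hw : w ∈ C
  · exact (hin w hw v hvw.symm).symm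
  rw [hcf v hv, hcf w hw]
  exact f.valid (v := ⟨v, hv⟩) (w := ⟨w, hw⟩) hvw

/-- A triangle-free `ISK4`-free graph with a maximal biclique containing `K₃,₃` is `3`-colorable if
all its proper induced subgraphs are. -/
theorem colorable_of_maximal_biclique {A B : Finset V} (hA : 3 ≤ A.card) (hB : 3 ≤ B.card)
    (hAB : ∀ a ∈ A, ∀ b ∈ B, G.Adj a b) (hT : ∀ a b c, G.Adj a b → G.Adj b c → ¬ G.Adj a c)
    (hfree : ISK4Free G) (hmaxA : ∀ v ∉ B, ¬ ∀ a ∈ A, G.Adj a v)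
    (hmaxB : ∀ v ∉ A, ¬ ∀ b ∈ B, G.Adj b v)
    (ih : ∀ S : Set V, S ≠ Set.univ → (G.induce S).Colorable 3) : G.Colorable 3 := by
  classical
  let K : Set V := {v | v ∈ A ∨ v ∈ B}
  obtain ⟨a₀, ha₀⟩ : A.Nonempty := Finset.card_pos.mp (by omega)
  obtain ⟨b₀, hb₀⟩ : B.Nonempty := Finset.card_pos.mp (by omega)
  have hAA : ∀ a ∈ A, ∀ a' ∈ A, ¬ G.Adj a a' := fun a ha a' ha' =>
    hT a b₀ a' (hAB a ha _ hb₀) (hAB a' ha' _ hb₀).symm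
  have hBB : ∀ b ∈ B, ∀ b' ∈ B, ¬ G.Adj b b' := fun b hb b' hb' =>
    hT b a₀ b' (hAB _ ha₀ b hb).symm (hAB _ ha₀ b' hb')
  by_cases hall : ∀ v, v ∈ K
  · refine ⟨Coloring.mk (fun v => if v ∈ A then 0 else 1) fun {v w} hvw => ?_⟩
    have hvwA : v ∈ A → w ∉ A := fun hv hw => hAA v hv w hw hvw
    have hvwB : v ∈ B → w ∉ B := fun hv hw => hBB v hv w hw hvw
    have hv := hall v
    have hw := hall w
    simp only [K, Set.mem_ofPred_eq] at hv hw
    split_ifs <;> simp <;> tauto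
  push Not at hall
  obtain ⟨v₀, hv₀⟩ := hall
  let C : Set V := {v | ∃ h : v ∈ Kᶜ, (G.induce Kᶜ).Reachable ⟨v₀, hv₀⟩ ⟨v, h⟩}
  let N : Set V := {x | x ∈ K ∧ ∃ c ∈ C, G.Adj x c}
  have hN : G.IsClique N := by
    rintro x ⟨hx, u, ⟨huK, hu⟩, hxu⟩ y ⟨hy, w, ⟨hwK, hw⟩, hyw⟩ hxy
    exact adj_of_attach_of_maximal_biclique (K := K) (fun _ => Iff.rfl) hA hB hAB hT hfree
      hmaxA hmaxB (u := ⟨u, huK⟩) (w := ⟨w, hwK⟩) (hu.symm.trans hw) hx hy hxy hxu hyw.symm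
  have hv₀C : v₀ ∈ C := ⟨hv₀, .rfl⟩
  refine colorable_of_clique_separation (C := C) hN ?_ ?_ (ih _ ?_) (ih _ ?_)
  · exact fun x hx hxC => hxC.1 hx.1
  · rintro c ⟨hcK, hc⟩ v hcv
    by_cases hv : v ∈ K
    · exact .inr ⟨hv, c, ⟨hcK, hc⟩, hcv.symm⟩
    · refine .inl ⟨hv, hc.trans (Adj.reachable ?_)⟩
      exact hcv
  · exact fun h => (h ▸ Set.mem_univ v₀ : v₀ ∈ Cᶜ) hv₀C
  · intro h
    obtain ⟨a, ha, a', ha', hne⟩ := Finset.one_lt_card.mp (show 1 < A.card by omega)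
    have hAN : ∀ a ∈ A, a ∈ N := fun a ha =>
      (h ▸ Set.mem_univ a : a ∈ C ∪ N).resolve_left fun h => h.1 (.inl ha)
    exact hAA a ha a' ha' (hN (hAN a ha) (hAN a' ha') hne)

/-- A coloring with `n` colors extends to a vertex of degree less than `n`. -/
theorem colorable_of_degree_lt [Fintype V] [DecidableRel G.Adj] {n : ℕ} {v : V}
    (hv : G.degree v < n) (h : (G.induce {v}ᶜ).Colorable n) : G.Colorable n := by
  classical
  obtain ⟨f⟩ := h
  have hvn : ∀ w : G.neighborFinset v, w.1 ∈ ({v} : Set V)ᶜ := fun w =>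
    ((G.mem_neighborFinset v w).mp w.2).ne'
  obtain ⟨k, hk⟩ : ∃ k, k ∉ (G.neighborFinset v).attach.image
      fun w : G.neighborFinset v => f ⟨w.1, hvn w⟩ := by
    by_contra! hk
    have := (Finset.card_le_card fun k _ => hk k : (Finset.univ : Finset (Fin n)).card ≤ _).trans
      Finset.card_image_le
    rw [Finset.card_attach, card_neighborFinset_eq_degree, Finset.card_univ,
      Fintype.card_fin] at this
    omega
  have hk' : ∀ w (hw : w ∈ ({v} : Set V)ᶜ), G.Adj v w → k ≠ f ⟨w, hw⟩ := by
    intro w hw hvw h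
    exact hk (Finset.mem_image.mpr
      ⟨⟨w, (G.mem_neighborFinset v w).mpr hvw⟩, Finset.mem_attach _ _, h.symm⟩)
  refine ⟨Coloring.mk (fun w => if h : w = v then k else f ⟨w, h⟩) fun {x y} hxy => ?_⟩
  by_cases hx : x = v <;> by_cases hy : y = v
  · exact absurd (hx.trans hy.symm) hxy.ne
  · subst hx
    simpa [hy] using hk' y hy hxy
  · subst hy
    simpa [hx] using (hk' x hx hxy.symm).symm
  · simpa [hx, hy] using f.valid (v := ⟨x, hx⟩) (w := ⟨y, hy⟩) hxy

/-- A finite graph that is not `K₃,₃`-free has a maximal biclique with both sides of size at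
least three. -/
theorem exists_maximal_biclique [Finite V] (h : ¬ K33Free G) :
    ∃ A B : Finset V, 3 ≤ A.card ∧ 3 ≤ B.card ∧ (∀ a ∈ A, ∀ b ∈ B, G.Adj a b) ∧
      (∀ v ∉ B, ¬ ∀ a ∈ A, G.Adj a v) ∧ ∀ v ∉ A, ¬ ∀ b ∈ B, G.Adj b v := by
  classical
  obtain ⟨S, ⟨e⟩⟩ := not_not.mp h
  let P : Finset V × Finset V → Prop := fun p =>
    3 ≤ p.1.card ∧ 3 ≤ p.2.card ∧ ∀ a ∈ p.1, ∀ b ∈ p.2, G.Adj a b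
  have hne : {p | P p}.Nonempty := by
    refine ⟨(Finset.univ.image fun i => (e.symm (.inl i)).1,
      Finset.univ.image fun i => (e.symm (.inr i)).1), ?_, ?_, ?_⟩
    · have hinj : Function.Injective fun i => (e.symm (.inl i)).1 :=
        Subtype.val_injective.comp (e.symm.injective.comp Sum.inl_injective)
      simp [Finset.card_image_of_injective _ hinj]
    · have hinj : Function.Injective fun i => (e.symm (.inr i)).1 :=
        Subtype.val_injective.comp (e.symm.injective.comp Sum.inr_injective)
      simp [Finset.card_image_of_injective _ hinj]
    · simp only [Finset.mem_image, Finset.mem_univ, true_and]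
      rintro _ ⟨i, rfl⟩ _ ⟨j, rfl⟩
      exact e.symm.map_adj_iff.mpr (by simp)
  obtain ⟨⟨A, B⟩, ⟨hA, hB, hAB⟩, hmax⟩ :=
    Set.exists_max_image _ (fun p => p.1.card + p.2.card) (Set.toFinite _) hne
  refine ⟨A, B, hA, hB, hAB, fun v hv hadj => ?_, fun v hv hadj => ?_⟩
  · have := hmax (A, insert v B) ⟨hA, by grind, by grind⟩
    simp [hv] at this
  · have := hmax (insert v A, B) ⟨hA.trans (Finset.card_le_card (Finset.subset_insert _ _)), hB,
      Finset.forall_mem_insert _ _ _ |>.mpr ⟨fun b hb => (hadj b hb).symm, hAB⟩⟩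
    simp [hv] at this

end SimpleGraph

/-- If every (nonempty) triangle-free, ISK4-free, K₃,₃-free graph has a
vertex of degree at most 2, then every triangle-free ISK4-free graph is 3-colorable. -/
theorem stmt_10
    (hyp : ∀ (W : Type) [Fintype W] (H : SimpleGraph W) [DecidableRel H.Adj],
      Nonempty W → H.CliqueFree 3 → ISK4Free H → K33Free H →
      ∃ v : W, H.degree v ≤ 2) :
    ∀ (V : Type) [Fintype V] (G : SimpleGraph V) [DecidableRel G.Adj],
      G.CliqueFree 3 → ISK4Free G → G.Colorable 3 := by
  intro V _ G _ hT hfree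
  classical
  induction hn : Fintype.card V using Nat.strong_induction_on generalizing V with
  | _ n ih =>
    subst hn
    have ih' : ∀ S : Set V, S ≠ Set.univ → (G.induce S).Colorable 3 := fun S hS =>
      ih _ (by
        obtain ⟨v, hv⟩ := (Set.ne_univ_iff_exists_notMem S).mp hS
        exact Fintype.card_subtype_lt hv) S (G.induce S)
        (SimpleGraph.CliqueFree.comap ⟨(SimpleGraph.Embedding.induce S).toCopy⟩ hT)
        (hfree.induce S) rfl
    by_cases hK : K33Free G
    · rcases isEmpty_or_nonempty V with hV | hV
      · exact SimpleGraph.Colorable.of_isEmpty 3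
      obtain ⟨v, hv⟩ := hyp V G hV hT hfree hK
      exact SimpleGraph.colorable_of_degree_lt (Nat.lt_succ_of_le hv)
        (ih' _ fun h => (h ▸ Set.mem_univ v : v ∈ ({v} : Set V)ᶜ) rfl)
    · obtain ⟨A, B, hA, hB, hAB, hmaxA, hmaxB⟩ := SimpleGraph.exists_maximal_biclique hK
      refine SimpleGraph.colorable_of_maximal_biclique hA hB hAB ?_ hfree hmaxA hmaxB ih'
      intro a b c hab hbc hac
      exact hT {a, b, c} (SimpleGraph.is3Clique_triple_iff.mpr ⟨hab, hac, hbc⟩)
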